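/- arXiv:1709.06343 — 2 statements merged into one kernel-verified Lean document; each statement's English description precedes it below -/
import Mathlib

section
/- Let Θ be a suitable set of moduli of continuity and let f, g : ℝ × ℝ^N → ℝ^M be weak Θ-Carathéodory functions that coincide Lebesgue-almost everywhere on ℝ^{1+N}. Then for every j ∈ ℕ, every compact interval I with rational endpoints, and every x ∈ K_j^I, one has f(t, x(t)) = g(t, x(t)) for almost every t ∈ I. -/
open MeasureTheory Set Filter Topology
open scoped RealInnerProductSpace

noncomputable section

abbrev Euc (n : ℕ) := EuclideanSpace ℝ (Fin n)

/-- A function `ℝ → ℝ` is locally integrable (w.r.t. Lebesgue measure) on every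
compact interval. -/
def LocInt (m : ℝ → ℝ) : Prop := ∀ a b : ℝ, IntegrableOn m (Icc a b)

section Defs

variable {N : ℕ} {F : Type*} [NormedAddCommGroup F] [NormedSpace ℝ F]

/-- The Carathéodory conditions (C1) and (C2). -/
def IsCara (f : ℝ → Euc N → F) : Prop :=
  StronglyMeasurable (Function.uncurry f) ∧
  ∀ K : Set (Euc N), IsCompact K → ∃ m : ℝ → ℝ, (∀ t, 0 ≤ m t) ∧ LocInt m ∧
    ∀ᵐ t : ℝ, ∀ x ∈ K, ‖f t x‖ ≤ m t

/-- A suitable set of moduli of continuity `Θ = {θ_j^{[q₁,q₂]}}`. -/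
structure SuitableModuli where
  θ : ℕ → ℚ → ℚ → ℝ → ℝ
  nonneg : ∀ j q₁ q₂ s, (0:ℝ) ≤ s → 0 ≤ θ j q₁ q₂ s
  cont : ∀ j q₁ q₂, ContinuousOn (θ j q₁ q₂) (Ici 0)
  mono : ∀ j q₁ q₂, MonotoneOn (θ j q₁ q₂) (Ici 0)
  zero : ∀ j q₁ q₂, θ j q₁ q₂ 0 = 0
  ordered : ∀ j₁ j₂ q₁ q₂ p₁ p₂, j₁ ≤ j₂ → p₁ ≤ q₁ → q₂ ≤ p₂ →
    ∀ s : ℝ, 0 ≤ s → θ j₁ q₁ q₂ s ≤ θ j₂ p₁ p₂ s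

/-- `x ∈ K_j^{[q₁,q₂]}`: continuous, bounded by `j` and with modulus of continuity
`θ_j^{[q₁,q₂]}` on `[q₁,q₂]`. -/
def inK {N : ℕ} (Θ : SuitableModuli) (j : ℕ) (q₁ q₂ : ℚ) (x : ℝ → Euc N) : Prop :=
  ContinuousOn x (Icc (q₁:ℝ) (q₂:ℝ)) ∧
  (∀ t ∈ Icc (q₁:ℝ) (q₂:ℝ), ‖x t‖ ≤ (j:ℝ)) ∧
  ∀ t ∈ Icc (q₁:ℝ) (q₂:ℝ), ∀ s ∈ Icc (q₁:ℝ) (q₂:ℝ), ‖x t - x s‖ ≤ Θ.θ j q₁ q₂ |t - s|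

/-- Weak Θ-Carathéodory functions: Carathéodory conditions plus condition (W). -/
def IsWTC (Θ : SuitableModuli) (f : ℝ → Euc N → F) : Prop :=
  IsCara f ∧
  ∀ (j : ℕ) (q₁ q₂ : ℚ) (xs : ℕ → ℝ → Euc N) (x : ℝ → Euc N),
    (∀ n, inK Θ j q₁ q₂ (xs n)) → inK Θ j q₁ q₂ x →
    TendstoUniformlyOn (fun n t => xs n t) x atTop (Icc (q₁:ℝ) (q₂:ℝ)) →
    Tendsto (fun n => ∫ t in Icc (q₁:ℝ) (q₂:ℝ), f t (xs n t)) atTop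
      (𝓝 (∫ t in Icc (q₁:ℝ) (q₂:ℝ), f t (x t)))

/-- Convergence in the `σ_Θ` sense:
`sup_{x ∈ K_j^I} ‖∫_I (f_n(t,x(t)) − f(t,x(t))) dt‖ → 0` for every `j` and `I`. -/
def SigmaTendsto (Θ : SuitableModuli) (fs : ℕ → ℝ → Euc N → F) (f : ℝ → Euc N → F) : Prop :=
  ∀ (j : ℕ) (q₁ q₂ : ℚ), ∀ ε > (0:ℝ), ∀ᶠ n in atTop, ∀ x : ℝ → Euc N, inK Θ j q₁ q₂ x →
    ‖∫ t in Icc (q₁:ℝ) (q₂:ℝ), (fs n t (x t) - f t (x t))‖ < ε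

end Defs

/-- Lipschitz Carathéodory functions. -/
def IsLC {N : ℕ} (f : ℝ → Euc N → Euc N) : Prop :=
  IsCara f ∧
  ∀ K : Set (Euc N), IsCompact K → ∃ l : ℝ → ℝ, LocInt l ∧
    ∀ᵐ t : ℝ, ∀ x ∈ K, ∀ y ∈ K, ‖f t x - f t y‖ ≤ l t * ‖x - y‖

/-- The optimal m-bound of `f` on the closed ball `B_j`. -/
def mOpt {N : ℕ} (f : ℝ → Euc N → Euc N) (j : ℕ) (t : ℝ) : ℝ :=
  sSup {v : ℝ | ∃ x : Euc N, ‖x‖ ≤ (j:ℝ) ∧ v = ‖f t x‖}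

/-- The time translation `f_r(s,x) = f(s+r,x)`. -/
def timeTranslate {N : ℕ} (f : ℝ → Euc N → Euc N) (r : ℝ) : ℝ → Euc N → Euc N :=
  fun s x => f (s + r) x

/-- `x` is a solution of `ẋ = g(t,x)`, `x(0) = x₀`, defined on `[0,∞)`. -/
def IsSolOn {N : ℕ} (g : ℝ → Euc N → Euc N) (x₀ : Euc N) (x : ℝ → Euc N) : Prop :=
  ContinuousOn x (Ici 0) ∧ ∀ t ∈ Ici (0:ℝ), x t = x₀ + ∫ s in (0:ℝ)..t, g s (x s)

section Helpers

variable {N : ℕ} {F : Type*} [NormedAddCommGroup F]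

/-- A Carathéodory function is locally integrable along a continuous curve. -/
lemma IsCara.locallyIntegrable_comp {f : ℝ → Euc N → F} (hf : IsCara f) {z : ℝ → Euc N}
    (hz : Continuous z) : LocallyIntegrable (fun t => f t (z t)) := by
  have hmeas : StronglyMeasurable fun t => f t (z t) :=
    hf.1.comp_measurable (measurable_id.prodMk hz.measurable)
  rw [locallyIntegrable_iff]
  intro k hk
  obtain ⟨a, ha⟩ := hk.bddBelow
  obtain ⟨b, hb⟩ := hk.bddAbove
  have hsub : k ⊆ Icc a b := fun t ht => ⟨ha ht, hb ht⟩
  obtain ⟨m, -, hm, hfm⟩ := hf.2 (z '' Icc a b) (isCompact_Icc.image hz)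
  refine IntegrableOn.mono_set (Integrable.mono' (hm a b) hmeas.aestronglyMeasurable ?_) hsub
  filter_upwards [ae_restrict_of_ae hfm, ae_restrict_mem measurableSet_Icc] with t ht htI
  exact ht _ (mem_image_of_mem z htI)

/-- Precomposition with a nonexpansive self-map of the interval preserves admissible curves. -/
lemma inK.comp {Θ : SuitableModuli} {j : ℕ} {q₁ q₂ : ℚ} {x : ℝ → Euc N} (hx : inK Θ j q₁ q₂ x)
    {φ : ℝ → ℝ} (hφ : Continuous φ) (hmaps : MapsTo φ (Icc (q₁ : ℝ) q₂) (Icc (q₁ : ℝ) q₂))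
    (hφ_le : ∀ t s, |φ t - φ s| ≤ |t - s|) : inK Θ j q₁ q₂ (fun t => x (φ t)) := by
  refine ⟨hx.1.comp hφ.continuousOn hmaps, fun t ht => hx.2.1 _ (hmaps ht), fun t ht s hs => ?_⟩
  exact (hx.2.2 _ (hmaps ht) _ (hmaps hs)).trans
    (Θ.mono j q₁ q₂ (mem_Ici.2 (abs_nonneg _)) (mem_Ici.2 (abs_nonneg _)) (hφ_le t s))

lemma inK_const (Θ : SuitableModuli) {j : ℕ} (q₁ q₂ : ℚ) {c : Euc N} (hc : ‖c‖ ≤ j) :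
    inK Θ j q₁ q₂ (fun _ => c) :=
  ⟨continuousOn_const, fun _ _ => hc, fun t _ s _ => by
    simpa using Θ.nonneg j q₁ q₂ |t - s| (abs_nonneg _)⟩

lemma inK.mono_nat {Θ : SuitableModuli} {j k : ℕ} {q₁ q₂ : ℚ} {x : ℝ → Euc N}
    (hx : inK Θ j q₁ q₂ x) (hjk : j ≤ k) : inK Θ k q₁ q₂ x :=
  ⟨hx.1, fun t ht => (hx.2.1 t ht).trans (by exact_mod_cast hjk), fun t ht s hs =>
    (hx.2.2 t ht s hs).trans (Θ.ordered _ _ _ _ _ _ hjk le_rfl le_rfl _ (abs_nonneg _))⟩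

lemma inK.add_const {Θ : SuitableModuli} {j : ℕ} {q₁ q₂ : ℚ} {x : ℝ → Euc N}
    (hx : inK Θ j q₁ q₂ x) {c : Euc N} (hc : ‖c‖ ≤ 1) :
    inK Θ (j + 1) q₁ q₂ (fun t => x t + c) := by
  refine ⟨hx.1.add continuousOn_const, fun t ht => ?_, fun t ht s hs => ?_⟩
  · push_cast
    exact (norm_add_le _ _).trans (add_le_add (hx.2.1 t ht) hc)
  · rw [add_sub_add_right_eq_sub]
    exact (hx.mono_nat j.le_succ).2.2 t ht s hs

/-- If `f` and `g` agree almost everywhere, they agree almost everywhere along almost every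
translate of a continuous curve. -/
lemma ae_ae_eq_along_translate {f g : ℝ → Euc N → F}
    (hf : StronglyMeasurable (Function.uncurry f)) (hg : StronglyMeasurable (Function.uncurry g))
    (hfg : ∀ᵐ p : ℝ × Euc N, f p.1 p.2 = g p.1 p.2) {z : ℝ → Euc N} (hz : Continuous z) :
    ∀ᵐ y : Euc N, ∀ᵐ t : ℝ, f t (z t + y) = g t (z t + y) := by
  have hφ : Measurable fun p : ℝ × Euc N => (p.1, z p.1 + p.2) := by fun_prop
  refine (Measure.ae_ae_comm
    ((hf.comp_measurable hφ).measurableSet_eq_fun (hg.comp_measurable hφ))).1 ?_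
  filter_upwards [Measure.ae_ae_of_ae_prod hfg] with t ht
  exact (eventually_add_left_iff volume (z t)).2 ht

variable [NormedSpace ℝ F]

/-- Two weak `Θ`-Carathéodory functions which agree almost everywhere have the same integral along
every continuous admissible curve. -/
lemma IsWTC.setIntegral_eq {Θ : SuitableModuli} {f g : ℝ → Euc N → F}
    (hf : IsWTC Θ f) (hg : IsWTC Θ g) (hfg : ∀ᵐ p : ℝ × Euc N, f p.1 p.2 = g p.1 p.2)
    {j : ℕ} {q₁ q₂ : ℚ} {z : ℝ → Euc N} (hz : Continuous z) (hzK : inK Θ j q₁ q₂ z) :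
    ∫ t in Icc (q₁ : ℝ) q₂, f t (z t) = ∫ t in Icc (q₁ : ℝ) q₂, g t (z t) := by
  have hdense := Measure.dense_of_ae (ae_ae_eq_along_translate hf.1.1 hg.1.1 hfg hz)
  have hex : ∀ n : ℕ, ∃ y : Euc N, (∀ᵐ t : ℝ, f t (z t + y) = g t (z t + y)) ∧
      dist 0 y < 1 / ((n : ℝ) + 1) := fun n =>
    hdense.exists_dist_lt 0 Nat.one_div_pos_of_nat
  choose y hy hy_lt using hex
  have hy_zero : Tendsto y atTop (𝓝 0) := by
    refine tendsto_iff_dist_tendsto_zero.2 (squeeze_zero (fun _ => dist_nonneg) (fun n => ?_)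
      (tendsto_one_div_add_atTop_nhds_zero_nat (𝕜 := ℝ)))
    rw [dist_comm]
    exact (hy_lt n).le
  have hyK : ∀ n, inK Θ (j + 1) q₁ q₂ (fun t => z t + y n) := fun n => by
    refine hzK.add_const ?_
    rw [← dist_zero_left]
    refine (hy_lt n).le.trans ((div_le_one (by positivity)).2 ?_)
    linarith [n.cast_nonneg (α := ℝ)]
  have hunif : TendstoUniformlyOn (fun n t => z t + y n) z atTop (Icc (q₁ : ℝ) q₂) := by
    rw [Metric.tendstoUniformlyOn_iff]
    intro ε hε
    filter_upwards [Metric.tendsto_nhds.1 hy_zero ε hε] with n hn t _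
    simpa [dist_eq_norm] using hn
  have hzK' := hzK.mono_nat j.le_succ
  refine tendsto_nhds_unique (hf.2 _ _ _ _ _ hyK hzK' hunif) ?_
  refine (hg.2 _ _ _ _ _ hyK hzK' hunif).congr fun n => ?_
  exact (integral_congr_ae (ae_restrict_of_ae (hy n))).symm

lemma IsWTC.intervalIntegral_eq {Θ : SuitableModuli} {f g : ℝ → Euc N → F}
    (hf : IsWTC Θ f) (hg : IsWTC Θ g) (hfg : ∀ᵐ p : ℝ × Euc N, f p.1 p.2 = g p.1 p.2)
    {j : ℕ} {q₁ q₂ : ℚ} (hq : q₁ ≤ q₂) {z : ℝ → Euc N} (hz : Continuous z)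
    (hzK : inK Θ j q₁ q₂ z) :
    ∫ t in (q₁ : ℝ)..q₂, f t (z t) = ∫ t in (q₁ : ℝ)..q₂, g t (z t) := by
  have hq' : (q₁ : ℝ) ≤ q₂ := by exact_mod_cast hq
  simpa only [intervalIntegral.integral_of_le hq', integral_Icc_eq_integral_Ioc] using
    hf.setIntegral_eq hg hfg hz hzK

/-- The integrals agree on initial rational subintervals: freeze the curve after time `b`, and
compare the remaining part with a constant curve. -/
lemma IsWTC.intervalIntegral_initial_eq {Θ : SuitableModuli} {f g : ℝ → Euc N → F}
    (hf : IsWTC Θ f) (hg : IsWTC Θ g) (hfg : ∀ᵐ p : ℝ × Euc N, f p.1 p.2 = g p.1 p.2)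
    {j : ℕ} {q₁ q₂ b : ℚ} (hb₁ : q₁ ≤ b) (hb₂ : b ≤ q₂) {z : ℝ → Euc N} (hz : Continuous z)
    (hzK : inK Θ j q₁ q₂ z) :
    ∫ t in (q₁ : ℝ)..b, f t (z t) = ∫ t in (q₁ : ℝ)..b, g t (z t) := by
  have hb₁' : (q₁ : ℝ) ≤ b := by exact_mod_cast hb₁
  have hb₂' : (b : ℝ) ≤ q₂ := by exact_mod_cast hb₂
  have hmin : Continuous fun t : ℝ => min t (b : ℝ) := by fun_prop
  have hw : Continuous fun t => z (min t (b : ℝ)) := hz.comp hmin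
  have hwK : inK Θ j q₁ q₂ fun t => z (min t (b : ℝ)) :=
    hzK.comp hmin (fun t ht => ⟨le_min ht.1 hb₁', (min_le_left _ _).trans ht.2⟩) fun t s =>
      (abs_min_sub_min_le_max _ _ _ _).trans (by simp)
  have split : ∀ h : ℝ → Euc N → F, IsCara h →
      ∫ t in (q₁ : ℝ)..q₂, h t (z (min t (b : ℝ))) =
        (∫ t in (q₁ : ℝ)..b, h t (z t)) + ∫ t in (b : ℝ)..q₂, h t (z b) := by
    intro h hh
    have hint : ∀ a c : ℝ, IntervalIntegrable (fun t => h t (z (min t (b : ℝ)))) volume a c :=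
      fun a c => ((hh.locallyIntegrable_comp hw).integrableOn_isCompact
        isCompact_uIcc).intervalIntegrable
    rw [← intervalIntegral.integral_add_adjacent_intervals (hint q₁ b) (hint b q₂)]
    congr 1
    · refine intervalIntegral.integral_congr fun t ht => ?_
      rw [uIcc_of_le hb₁'] at ht
      simp only [min_eq_left ht.2]
    · refine intervalIntegral.integral_congr fun t ht => ?_
      rw [uIcc_of_le hb₂'] at ht
      simp only [min_eq_right ht.1]
  have hconst := hf.intervalIntegral_eq hg hfg hb₂ (continuous_const (y := z b))
    (inK_const Θ b q₂ (hzK.2.1 b ⟨hb₁', hb₂'⟩))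
  have htotal := hf.intervalIntegral_eq hg hfg (hb₁.trans hb₂) hw hwK
  rw [split f hf.1, split g hg.1, hconst] at htotal
  exact add_right_cancel htotal

/-- A locally integrable function whose primitive vanishes at all rational points of an open
interval vanishes almost everywhere on this interval. -/
lemma ae_eq_zero_of_forall_rat_intervalIntegral_eq_zero [CompleteSpace F] {h : ℝ → F}
    (hh : LocallyIntegrable h) {a b : ℝ}
    (hzero : ∀ q : ℚ, (q : ℝ) ∈ Ioo a b → ∫ t in a..q, h t = 0) :
    ∀ᵐ t ∂(volume.restrict (Icc a b)), h t = 0 := by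
  have hcont : Continuous fun u => ∫ t in a..u, h t :=
    intervalIntegral.continuous_primitive (fun _ _ =>
      (hh.integrableOn_isCompact isCompact_uIcc).intervalIntegrable) a
  have hall : Ioo a b ⊆ {u | ∫ t in a..u, h t = 0} := by
    refine (Rat.denseRange_cast (𝕜 := ℝ)).open_subset_closure_inter isOpen_Ioo |>.trans ?_
    refine closure_minimal ?_ (isClosed_eq hcont continuous_const)
    rintro _ ⟨hu, q, rfl⟩
    exact hzero q hu
  rw [← restrict_Ioo_eq_restrict_Icc]
  filter_upwards [ae_restrict_of_ae (LocallyIntegrable.ae_hasDerivAt_integral hh),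
    ae_restrict_mem measurableSet_Ioo] with t ht htI
  refine (ht a).unique ((hasDerivAt_const t (0 : F)).congr_of_eventuallyEq ?_)
  filter_upwards [isOpen_Ioo.mem_nhds htI] with u hu using hall hu

end Helpers

/-- Two weak Θ-Carathéodory functions that coincide a.e. on `ℝ^{1+N}`
agree along every admissible curve `x ∈ K_j^I`, for a.e. `t ∈ I`. -/
theorem stmt0 {N M : ℕ} (Θ : SuitableModuli)
    (f g : ℝ → Euc N → Euc M)
    (hf : IsWTC Θ f) (hg : IsWTC Θ g)
    (hfg : ∀ᵐ p : ℝ × Euc N, f p.1 p.2 = g p.1 p.2)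
    (j : ℕ) (q₁ q₂ : ℚ) (x : ℝ → Euc N) (hx : inK Θ j q₁ q₂ x) :
    ∀ᵐ t ∂(volume.restrict (Icc (q₁:ℝ) (q₂:ℝ))), f t (x t) = g t (x t) := by
  rcases lt_or_ge q₂ q₁ with hq | hq
  · rw [Icc_eq_empty (not_le.2 (by exact_mod_cast hq))]
    simp
  have hq' : (q₁ : ℝ) ≤ q₂ := by exact_mod_cast hq
  set φ : ℝ → ℝ := fun t => max (min t q₂) q₁ with hφ_def
  have hφ : Continuous φ := by fun_prop
  have hmaps : ∀ t, φ t ∈ Icc (q₁ : ℝ) q₂ := fun t =>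
    ⟨le_max_right _ _, max_le (min_le_right _ _) hq'⟩
  have hz : Continuous fun t => x (φ t) := hx.1.comp_continuous hφ hmaps
  have hzK : inK Θ j q₁ q₂ fun t => x (φ t) :=
    hx.comp hφ (fun t _ => hmaps t) fun t s =>
      (abs_max_sub_max_le_abs _ _ _).trans ((abs_min_sub_min_le_max _ _ _ _).trans (by simp))
  have hfz := hf.1.locallyIntegrable_comp hz
  have hgz := hg.1.locallyIntegrable_comp hz
  have key := ae_eq_zero_of_forall_rat_intervalIntegral_eq_zero (hfz.sub hgz)
    (a := q₁) (b := q₂) fun b hb => by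
      simp only [Pi.sub_apply]
      rw [intervalIntegral.integral_sub
        (hfz.integrableOn_isCompact isCompact_uIcc).intervalIntegrable
        (hgz.integrableOn_isCompact isCompact_uIcc).intervalIntegrable, sub_eq_zero]
      exact hf.intervalIntegral_initial_eq hg hfg (by exact_mod_cast hb.1.le)
        (by exact_mod_cast hb.2.le) hz hzK
  filter_upwards [key, ae_restrict_mem measurableSet_Icc] with t ht htI
  have hφt : φ t = t := by simp [hφ_def, htI.1, htI.2]
  simpa [hφt, sub_eq_zero] using ht
end
end

section
/- Let (a_n) be a sequence of locally integrable real-valued functions on ℝ such that sup_n ∫_{−r}^{r} |a_n(s)| ds < ∞ for every r > 0. Suppose there is a locally integrable a : ℝ → ℝ such that for all rationals t₁ < t₂ one has ∫_{t₁}^{t₂} a_n(s) ds → ∫_{t₁}^{t₂} a(s) ds as n → ∞. Then for all rationals t₁ < t₂ and every sequence (φ_n) of continuous functions on [t₁, t₂] converging uniformly to a continuous function φ, one has ∫_{t₁}^{t₂} a_n(s) φ_n(s) ds → ∫_{t₁}^{t₂} a(s) φ(s) ds as n → ∞. -/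
open MeasureTheory Set Filter Topology
open scoped RealInnerProductSpace

noncomputable section

theorem LocInt.intervalIntegrable {m : ℝ → ℝ} (hm : LocInt m) {u v : ℝ} (huv : u ≤ v) :
    IntervalIntegrable m volume u v :=
  (intervalIntegrable_iff_integrableOn_Icc_of_le huv).2 (hm u v)

/-- Replacing a continuous factor by an `η`-close step function changes the integral by at most
`η` times the `L¹` norm of the other factor. -/
theorem abs_integral_mul_sub_sum_le {b ψ : ℝ → ℝ} (hb : LocInt b) {p : ℕ → ℝ} (hp : Monotone p)
    (c : ℕ → ℝ) (η : ℝ) (M : ℕ) (hψ : ContinuousOn ψ (Icc (p 0) (p M)))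
    (hc : ∀ k < M, ∀ s ∈ Icc (p k) (p (k + 1)), |ψ s - c k| ≤ η) :
    |(∫ s in p 0..p M, b s * ψ s) - ∑ k ∈ Finset.range M, c k * ∫ s in p k..p (k + 1), b s| ≤
      η * ∫ s in p 0..p M, |b s| := by
  induction M with
  | zero => simp
  | succ M ih =>
    have h0 : p 0 ≤ p M := hp (Nat.zero_le _)
    have h1 : p M ≤ p (M + 1) := hp (Nat.le_succ _)
    have hψ0 : ContinuousOn ψ (Icc (p 0) (p M)) := hψ.mono (Icc_subset_Icc_right h1)
    have hψ1 : ContinuousOn ψ (Icc (p M) (p (M + 1))) := hψ.mono (Icc_subset_Icc_left h0)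
    have hb0 := hb.intervalIntegrable h0
    have hb1 := hb.intervalIntegrable h1
    have hm0 : IntervalIntegrable (fun s => b s * ψ s) volume (p 0) (p M) :=
      hb0.mul_continuousOn (by rwa [uIcc_of_le h0])
    have hm1 : IntervalIntegrable (fun s => b s * ψ s) volume (p M) (p (M + 1)) :=
      hb1.mul_continuousOn (by rwa [uIcc_of_le h1])
    have ih' := ih hψ0 fun k hk => hc k (hk.trans (Nat.lt_succ_self M))
    have hlast : |(∫ s in p M..p (M + 1), b s * ψ s) - c M * ∫ s in p M..p (M + 1), b s| ≤
        η * ∫ s in p M..p (M + 1), |b s| := by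
      rw [← intervalIntegral.integral_const_mul, ← intervalIntegral.integral_const_mul,
        ← intervalIntegral.integral_sub hm1 (hb1.const_mul _), ← Real.norm_eq_abs]
      refine intervalIntegral.norm_integral_le_of_norm_le h1 (ae_of_all _ fun s hs => ?_)
        (hb1.abs.const_mul η)
      have hs' := hc M (Nat.lt_succ_self M) s (Ioc_subset_Icc_self hs)
      rw [Real.norm_eq_abs, show b s * ψ s - c M * b s = (ψ s - c M) * b s by ring, abs_mul]
      gcongr
    rw [Finset.sum_range_succ, ← intervalIntegral.integral_add_adjacent_intervals hm0 hm1,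
      ← intervalIntegral.integral_add_adjacent_intervals hb0.abs hb1.abs, mul_add,
      add_sub_add_comm]
    exact (abs_add_le _ _).trans (add_le_add ih' hlast)

/-- a convergence lemma for products of weakly convergent `L¹_loc`
sequences with uniformly convergent continuous factors. -/
theorem stmt6 (a_seq : ℕ → ℝ → ℝ) (a : ℝ → ℝ)
    (ha_int : ∀ n, LocInt (a_seq n)) (ha : LocInt a)
    (hbdd : ∀ r > (0:ℝ), ∃ C : ℝ, ∀ n, ∫ s in Icc (-r) r, |a_seq n s| ≤ C)
    (hconv : ∀ t₁ t₂ : ℚ, t₁ < t₂ →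
      Tendsto (fun n => ∫ s in Icc (t₁:ℝ) (t₂:ℝ), a_seq n s) atTop
        (𝓝 (∫ s in Icc (t₁:ℝ) (t₂:ℝ), a s)))
    (t₁ t₂ : ℚ) (h : t₁ < t₂)
    (φs : ℕ → ℝ → ℝ) (φ : ℝ → ℝ)
    (hφs : ∀ n, ContinuousOn (φs n) (Icc (t₁:ℝ) (t₂:ℝ)))
    (hφ : ContinuousOn φ (Icc (t₁:ℝ) (t₂:ℝ)))
    (hφconv : TendstoUniformlyOn φs φ atTop (Icc (t₁:ℝ) (t₂:ℝ))) :
    Tendsto (fun n => ∫ s in Icc (t₁:ℝ) (t₂:ℝ), a_seq n s * φs n s) atTop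
      (𝓝 (∫ s in Icc (t₁:ℝ) (t₂:ℝ), a s * φ s)) := by
  have h' : (t₁ : ℝ) < t₂ := by exact_mod_cast h
  have hIcc : ∀ f : ℝ → ℝ, ∫ s in Icc (t₁:ℝ) (t₂:ℝ), f s = ∫ s in (t₁:ℝ)..t₂, f s := fun f => by
    rw [intervalIntegral.integral_of_le h'.le, integral_Icc_eq_integral_Ioc]
  obtain ⟨C, hC⟩ : ∃ C : ℝ, ∀ n, ∫ s in (t₁:ℝ)..t₂, |a_seq n s| ≤ C := by
    obtain ⟨C, hC⟩ := hbdd (|(t₁:ℝ)| + |(t₂:ℝ)| + 1) (by positivity)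
    refine ⟨C, fun n => le_trans ?_ (hC n)⟩
    rw [← hIcc]
    refine setIntegral_mono_set (ha_int n _ _).abs (ae_of_all _ fun _ => abs_nonneg _)
      (Icc_subset_Icc ?_ ?_).eventuallyLE
    · linarith [neg_abs_le (t₁:ℝ), abs_nonneg (t₂:ℝ)]
    · linarith [le_abs_self (t₂:ℝ), abs_nonneg (t₁:ℝ)]
  have hC0 : 0 ≤ C :=
    (intervalIntegral.integral_nonneg h'.le fun _ _ => abs_nonneg _).trans (hC 0)
  set D := ∫ s in (t₁:ℝ)..t₂, |a s|
  have hD0 : 0 ≤ D := intervalIntegral.integral_nonneg h'.le fun _ _ => abs_nonneg _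
  simp only [hIcc]
  rw [Metric.tendsto_atTop']
  intro ε hε
  set η := ε / (2 * (C + D + 1)) with hη_def
  have hη : 0 < η := by positivity
  have hηCD : η * C + η * D < ε / 2 := by
    have : η * (C + D + 1) = ε / 2 := by
      rw [hη_def]
      field_simp
    linarith
  obtain ⟨δ, hδ, hφδ⟩ := Metric.uniformContinuousOn_iff.1
    (isCompact_Icc.uniformContinuousOn_of_continuous hφ) (η / 2) (by positivity)
  obtain ⟨M, hM⟩ := exists_nat_gt (((t₂:ℝ) - t₁) / δ)
  have hM0 : (0:ℝ) < M := lt_of_le_of_lt (div_nonneg (sub_nonneg.2 h'.le) hδ.le) hM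
  have hstep : ((t₂:ℝ) - t₁) / M < δ := by
    rw [div_lt_iff₀ hδ] at hM
    rw [div_lt_iff₀ hM0]
    linarith
  let q : ℕ → ℚ := fun k => t₁ + k * ((t₂ - t₁) / M)
  have hMQ : (0:ℚ) < M := by exact_mod_cast hM0
  have hqs : StrictMono q := strictMono_nat_of_lt_succ fun k => by
    have : 0 < (t₂ - t₁) / (M:ℚ) := div_pos (sub_pos.2 h) hMQ
    simp only [q, Nat.cast_add, Nat.cast_one]
    linarith
  let p : ℕ → ℝ := fun k => (q k : ℝ)
  have hp : Monotone p := fun i j hij => by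
    simp only [p]
    exact_mod_cast hqs.monotone hij
  have hp0 : p 0 = t₁ := by simp [p, q]
  have hpM : p M = t₂ := by
    simp only [p]
    congr 1
    simp only [q]
    field_simp
    ring
  have hpsucc : ∀ k, p (k + 1) = p k + ((t₂:ℝ) - t₁) / M := fun k => by
    simp only [p, q]
    push_cast
    ring
  have hpsub : ∀ k < M, Icc (p k) (p (k + 1)) ⊆ Icc (t₁:ℝ) t₂ := fun k hk => by
    rw [← hp0, ← hpM]
    exact Icc_subset_Icc (hp (Nat.zero_le k)) (hp hk)
  have hφp : ∀ k < M, ∀ s ∈ Icc (p k) (p (k + 1)), |φ s - φ (p k)| ≤ η / 2 := fun k hk s hs => by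
    have hdist : dist s (p k) < δ := by
      rw [Real.dist_eq, abs_of_nonneg (sub_nonneg.2 hs.1)]
      linarith [hs.2, hpsucc k]
    exact (hφδ s (hpsub k hk hs) (p k)
      (hpsub k hk (left_mem_Icc.2 (hp (Nat.le_succ k)))) hdist).le
  have hsum : Tendsto
      (fun n => ∑ k ∈ Finset.range M, φ (p k) * ∫ s in p k..p (k + 1), a_seq n s) atTop
      (𝓝 (∑ k ∈ Finset.range M, φ (p k) * ∫ s in p k..p (k + 1), a s)) := by
    refine tendsto_finsetSum _ fun k _ => Tendsto.const_mul _ ?_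
    have hk := hconv (q k) (q (k + 1)) (hqs (Nat.lt_succ_self k))
    simpa only [intervalIntegral.integral_of_le (hp (Nat.le_succ k)),
      integral_Icc_eq_integral_Ioc] using hk
  have hlim := abs_integral_mul_sub_sum_le ha hp (fun k => φ (p k)) η M
    (by rwa [hp0, hpM]) fun k hk s hs => (hφp k hk s hs).trans (by linarith)
  rw [hp0, hpM] at hlim
  have hev := (Metric.tendstoUniformlyOn_iff.1 hφconv (η / 2) (by positivity)).and
    (Metric.tendsto_nhds.1 hsum (ε / 2) (by positivity))
  obtain ⟨n₀, hn₀⟩ := eventually_atTop.1 hev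
  refine ⟨n₀, fun n hn => ?_⟩
  obtain ⟨hunif, hclose⟩ := hn₀ n hn.le
  have happ := abs_integral_mul_sub_sum_le (ha_int n) hp (fun k => φ (p k)) η M
    (by rw [hp0, hpM]; exact hφs n) fun k hk s hs => by
      have h1 := hunif s (hpsub k hk hs)
      rw [dist_comm, Real.dist_eq] at h1
      have h2 := abs_sub_le (φs n s) (φ s) (φ (p k))
      linarith [hφp k hk s hs]
  rw [hp0, hpM] at happ
  have hCn : η * ∫ s in (t₁:ℝ)..t₂, |a_seq n s| ≤ η * C := by
    gcongr
    exact hC n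
  rw [Real.dist_eq, abs_lt] at hclose ⊢
  rw [abs_le] at happ hlim
  constructor <;> linarith [hclose.1, hclose.2, happ.1, happ.2, hlim.1, hlim.2]
end
end
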